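/- Let E be a real inner product space, θ₀, θ̃_t, θ_{t−1} ∈ E, with γ_t := ‖θ̃_t − θ₀‖ > 0 and γ_{t−1} := ‖θ_{t−1} − θ₀‖, and deviation ratio r_t := max{0, γ_t − γ_{t−1}} / γ_t. If 0 ≤ λ ≤ 1 then the SPD update θ_t = θ̃_t − λ r_t·(θ̃_t − θ₀) satisfies γ_{t−1} ≤ ‖θ_t − θ₀‖ ≤ γ_t whenever γ_t ≥ γ_{t−1}, and ‖θ_t − θ₀‖ = γ_t whenever γ_t ≤ γ_{t−1}. -/

import Mathlib

/-- Weak-regularization regime of SPD: for `0 ≤ λ ≤ 1`, the SPD update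
`θ_t = θ̃_t − λ r_t·(θ̃_t − θ₀)` satisfies `γ_{t−1} ≤ ‖θ_t − θ₀‖ ≤ γ_t` whenever
`γ_t ≥ γ_{t−1}`, and `‖θ_t − θ₀‖ = γ_t` whenever `γ_t ≤ γ_{t−1}`. -/
theorem spd_weak_regularization {E : Type*} [NormedAddCommGroup E]
    [InnerProductSpace ℝ E] (θ₀ θtilde θprev θt : E)
    (γt γprev rt lam : ℝ)
    (hγt : γt = ‖θtilde - θ₀‖) (hγprev : γprev = ‖θprev - θ₀‖)
    (hγtpos : 0 < γt)
    (hrt : rt = max 0 (γt - γprev) / γt)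
    (hlam0 : 0 ≤ lam) (hlam1 : lam ≤ 1)
    (hθt : θt = θtilde - (lam * rt) • (θtilde - θ₀)) :
    (γprev ≤ γt → γprev ≤ ‖θt - θ₀‖ ∧ ‖θt - θ₀‖ ≤ γt) ∧
    (γt ≤ γprev → ‖θt - θ₀‖ = γt) := by
  have hp : 0 ≤ γprev := hγprev ▸ norm_nonneg _
  have hm : rt * γt = max 0 (γt - γprev) := by
    rw [hrt]; field_simp
  have hm0 : 0 ≤ max 0 (γt - γprev) := le_max_left _ _
  have hm1 : max 0 (γt - γprev) ≤ γt := max_le hγtpos.le (by linarith)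
  have hr0 : 0 ≤ rt := by rw [hrt]; positivity
  have hr1 : rt ≤ 1 := by rw [hrt]; exact (div_le_one hγtpos).2 hm1
  have hv : θt - θ₀ = (1 - lam * rt) • (θtilde - θ₀) := by
    rw [hθt, sub_smul, one_smul]; abel
  have hn : ‖θt - θ₀‖ = γt - lam * max 0 (γt - γprev) := by
    rw [hv, norm_smul, ← hγt, Real.norm_of_nonneg (by nlinarith), ← hm]; ring
  rw [hn]
  constructor
  · intro h
    rw [max_eq_right (by linarith)]
    constructor <;> nlinarith
  · intro h
    rw [max_eq_left (by linarith)]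
    ring
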